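/- arXiv:2412.09061 — 2 statements merged into one kernel-verified Lean document; each statement's English description precedes it below -/
import Mathlib

section
/- There exists C > 0, depending only on χ₁, such that for all m ≠ 0, all t ≠ 0 and all f ∈ 𝒮(ℝ): sup_{x ∈ ℝ} |(2π)^{−1} ∫_ℝ e^{ixξ} cos(t√(ξ⁴+m²)) χ₁(ξ⁴) f̂(ξ) dξ| ≤ C ⟨m⟩^{1/2} |t|^{−1/4} ‖f‖_{L¹(ℝ)} and sup_{x ∈ ℝ} |(2π)^{−1} ∫_ℝ e^{ixξ} cos(t√(ξ⁴+m²)) χ₂(ξ⁴) f̂(ξ) dξ| ≤ C ⟨m⟩ |t|^{−1/2} ‖f‖_{L¹(ℝ)}. In other words, ‖cos(t√(Δ²+m²)) χ₁(Δ²)‖_{L¹→L^∞} ≲ ⟨m⟩^{1/2} |t|^{−1/4} and ‖cos(t√(Δ²+m²)) χ₂(Δ²)‖_{L¹→L^∞} ≲ ⟨m⟩ |t|^{−1/2}. -/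
open MeasureTheory
open Complex Set Filter Topology

lemma norm_integral_cexp_le {θ : ℝ → ℝ} {a b : ℝ} (hab : a ≤ b) :
    ‖∫ x in a..b, cexp (I * (θ x : ℂ))‖ ≤ b - a := by
  have := intervalIntegral.norm_integral_le_of_norm_le_const (a := a) (b := b) (C := 1)
    (f := fun x => cexp (I * (θ x : ℂ))) (fun x _ => (norm_exp_I_mul_ofReal _).le)
  rwa [one_mul, abs_of_nonneg (sub_nonneg.2 hab)] at this

/-- First derivative van der Corput lemma, for a phase with nondecreasing derivative. -/
lemma norm_integral_cexp_le_of_le_deriv {θ θ' θ'' : ℝ → ℝ} {a b l : ℝ} (hab : a ≤ b)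
    (hl : 0 < l) (hθ : ∀ x, HasDerivAt θ (θ' x) x) (hθ' : ∀ x, HasDerivAt θ' (θ'' x) x)
    (hc : Continuous θ'') (hle : ∀ x ∈ Icc a b, l ≤ θ' x) (hconv : ∀ x ∈ Icc a b, 0 ≤ θ'' x) :
    ‖∫ x in a..b, cexp (I * (θ x : ℂ))‖ ≤ 3 / l := by
  have hθc : Continuous θ := continuous_iff_continuousAt.2 fun x => (hθ x).continuousAt
  have hθ'c : Continuous θ' := continuous_iff_continuousAt.2 fun x => (hθ' x).continuousAt
  have hpos : ∀ x ∈ Icc a b, 0 < θ' x := fun x hx => hl.trans_le (hle x hx)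
  have hderiv : ∀ x ∈ uIcc a b, HasDerivAt (fun x => cexp (I * (θ x : ℂ)) * (I * (θ' x : ℂ))⁻¹)
      (cexp (I * (θ x : ℂ)) - cexp (I * (θ x : ℂ)) * (θ'' x / (I * (θ' x : ℂ) ^ 2))) x := by
    intro x hx
    rw [uIcc_of_le hab] at hx
    have hne : (θ' x : ℂ) ≠ 0 := ofReal_ne_zero.2 (hpos x hx).ne'
    have h1 := ((hθ x).ofReal_comp.const_mul I).cexp
    have h2 := ((hθ' x).ofReal_comp.const_mul I).fun_inv (mul_ne_zero I_ne_zero hne)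
    convert! h1.mul h2 using 1
    field_simp [I_ne_zero]
    ring_nf
  have hc1 : ContinuousOn (fun x => cexp (I * (θ x : ℂ))) (uIcc a b) := by fun_prop
  have hne : ∀ x ∈ uIcc a b, θ' x ≠ 0 := fun x hx => by
    rw [uIcc_of_le hab] at hx; exact (hpos x hx).ne'
  have hc2 : ContinuousOn
      (fun x => cexp (I * (θ x : ℂ)) * (θ'' x / (I * (θ' x : ℂ) ^ 2))) (uIcc a b) := by
    refine hc1.mul (ContinuousOn.div (by fun_prop) (by fun_prop) fun x hx => ?_)
    exact mul_ne_zero I_ne_zero (pow_ne_zero _ (ofReal_ne_zero.2 (hne x hx)))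
  have hc3 : ContinuousOn (fun x => θ'' x / θ' x ^ 2) (uIcc a b) :=
    ContinuousOn.div (by fun_prop) (by fun_prop) fun x hx => pow_ne_zero _ (hne x hx)
  have hFTC := intervalIntegral.integral_eq_sub_of_hasDerivAt hderiv
    (hc1.sub hc2).intervalIntegrable
  rw [intervalIntegral.integral_sub hc1.intervalIntegrable hc2.intervalIntegrable] at hFTC
  have hFTC' : ∫ x in a..b, θ'' x / θ' x ^ 2 = (θ' a)⁻¹ - (θ' b)⁻¹ := by
    rw [intervalIntegral.integral_eq_sub_of_hasDerivAt (f := fun x => -(θ' x)⁻¹)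
      (fun x hx => ?_) hc3.intervalIntegrable]
    · ring
    · convert! ((hθ' x).fun_inv (hne x hx)).neg using 1
      ring
  have hbdry : ∀ x ∈ Icc a b, ‖cexp (I * (θ x : ℂ)) * (I * (θ' x : ℂ))⁻¹‖ ≤ 1 / l := by
    intro x hx
    rw [norm_mul, norm_exp_I_mul_ofReal, norm_inv, norm_mul, norm_I, one_mul, one_mul,
      Complex.norm_real, Real.norm_of_nonneg (hpos x hx).le, ← one_div]
    exact one_div_le_one_div_of_le hl (hle x hx)
  have hrem : ‖∫ x in a..b, cexp (I * (θ x : ℂ)) * (θ'' x / (I * (θ' x : ℂ) ^ 2))‖ ≤ 1 / l := by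
    refine (intervalIntegral.norm_integral_le_of_norm_le hab (g := fun x => θ'' x / θ' x ^ 2)
      (Eventually.of_forall fun x hx => ?_) hc3.intervalIntegrable).trans ?_
    · have hx' := Ioc_subset_Icc_self hx
      rw [norm_mul, norm_exp_I_mul_ofReal, norm_div, norm_mul, norm_I, norm_pow, one_mul, one_mul,
        Complex.norm_real, Complex.norm_real, Real.norm_of_nonneg (hpos x hx').le,
        Real.norm_of_nonneg (hconv x hx')]
    · rw [hFTC']
      have h1 : (θ' a)⁻¹ ≤ 1 / l := by
        rw [← one_div]; exact one_div_le_one_div_of_le hl (hle a (left_mem_Icc.2 hab))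
      have h2 : 0 < (θ' b)⁻¹ := inv_pos.2 (hpos b (right_mem_Icc.2 hab))
      linarith
  rw [sub_eq_iff_eq_add.1 hFTC]
  refine (norm_add_le _ _).trans ((add_le_add (norm_sub_le _ _) hrem).trans ?_)
  have h1 := hbdry a (left_mem_Icc.2 hab)
  have h2 := hbdry b (right_mem_Icc.2 hab)
  calc _ ≤ 1 / l + 1 / l + 1 / l := by gcongr
    _ = 3 / l := by ring

lemma norm_integral_cexp_le_of_linear_le_deriv {θ θ' θ'' : ℝ → ℝ} {c b μ : ℝ} (hcb : c ≤ b)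
    (hμ : 0 < μ) (hθ : ∀ x, HasDerivAt θ (θ' x) x) (hθ' : ∀ x, HasDerivAt θ' (θ'' x) x)
    (hc : Continuous θ'') (hle : ∀ x ∈ Icc c b, μ * (x - c) ≤ θ' x)
    (hconv : ∀ x ∈ Icc c b, 0 ≤ θ'' x) :
    ‖∫ x in c..b, cexp (I * (θ x : ℂ))‖ ≤ 4 / √μ := by
  have hs : 0 < √μ := Real.sqrt_pos.2 hμ
  have hd : 0 < 1 / √μ := by positivity
  rcases le_total (b - c) (1 / √μ) with h | h
  · refine (norm_integral_cexp_le hcb).trans (h.trans ?_)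
    gcongr; norm_num
  · have hθc : Continuous θ := continuous_iff_continuousAt.2 fun x => (hθ x).continuousAt
    have hci : Continuous fun x => cexp (I * (θ x : ℂ)) := by fun_prop
    rw [← intervalIntegral.integral_add_adjacent_intervals
      (hci.intervalIntegrable c (c + 1 / √μ)) (hci.intervalIntegrable (c + 1 / √μ) b)]
    have h1 : ‖∫ x in c..(c + 1 / √μ), cexp (I * (θ x : ℂ))‖ ≤ 1 / √μ :=
      (norm_integral_cexp_le (by linarith)).trans (by linarith)
    have h2 := norm_integral_cexp_le_of_le_deriv (a := c + 1 / √μ) (b := b) (by linarith) hs hθ hθ'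
      hc (fun x hx => ?_) (fun x hx => hconv x ⟨by linarith [hx.1], hx.2⟩)
    · refine (norm_add_le _ _).trans ((add_le_add h1 h2).trans (le_of_eq (by ring)))
    · refine le_trans ?_ (hle x ⟨by linarith [hx.1], hx.2⟩)
      calc √μ = μ * (1 / √μ) := by
            rw [mul_one_div, eq_div_iff hs.ne', Real.mul_self_sqrt hμ.le]
        _ ≤ μ * (x - c) := by gcongr; linarith [hx.1]

/-- Second derivative van der Corput lemma. -/
lemma norm_integral_cexp_le_of_le_deriv_deriv {θ θ' θ'' : ℝ → ℝ} {a b μ : ℝ} (hab : a ≤ b)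
    (hμ : 0 < μ) (hθ : ∀ x, HasDerivAt θ (θ' x) x) (hθ' : ∀ x, HasDerivAt θ' (θ'' x) x)
    (hc : Continuous θ'') (hle : ∀ x ∈ Icc a b, μ ≤ θ'' x) :
    ‖∫ x in a..b, cexp (I * (θ x : ℂ))‖ ≤ 8 / √μ := by
  have hθc : Continuous θ := continuous_iff_continuousAt.2 fun x => (hθ x).continuousAt
  have hθ'c : Continuous θ' := continuous_iff_continuousAt.2 fun x => (hθ' x).continuousAt
  have hci : Continuous fun x => cexp (I * (θ x : ℂ)) := by fun_prop
  have hmvt : ∀ x ∈ Icc a b, ∀ y ∈ Icc a b, x ≤ y → μ * (y - x) ≤ θ' y - θ' x := by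
    refine (convex_Icc a b).mul_sub_le_image_sub_of_le_deriv hθ'c.continuousOn
      (fun x _ => (hθ' x).differentiableAt.differentiableWithinAt) fun x hx => ?_
    rw [(hθ' x).deriv]
    exact hle x (interior_subset hx)
  obtain ⟨c, hcm, hr, hl⟩ : ∃ c ∈ Icc a b, (c < b → 0 ≤ θ' c) ∧ (a < c → θ' c ≤ 0) := by
    rcases le_total 0 (θ' a) with h | h
    · exact ⟨a, left_mem_Icc.2 hab, fun _ => h, fun h => absurd h (lt_irrefl _)⟩
    rcases le_total (θ' b) 0 with h' | h'
    · exact ⟨b, right_mem_Icc.2 hab, fun h => absurd h (lt_irrefl _), fun _ => h'⟩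
    obtain ⟨c, hc, h0⟩ := intermediate_value_Icc hab hθ'c.continuousOn ⟨h, h'⟩
    exact ⟨c, hc, fun _ => h0.ge, fun _ => h0.le⟩
  have hpos : ∀ x ∈ Icc a b, 0 ≤ θ'' x := fun x hx => hμ.le.trans (hle x hx)
  have h4 : 0 ≤ 4 / √μ := by positivity
  have hright : ‖∫ x in c..b, cexp (I * (θ x : ℂ))‖ ≤ 4 / √μ := by
    rcases hcm.2.eq_or_lt with h | h
    · simpa [h] using h4
    refine norm_integral_cexp_le_of_linear_le_deriv h.le hμ hθ hθ' hc (fun x hx => ?_)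
      fun x hx => hpos x ⟨hcm.1.trans hx.1, hx.2⟩
    linarith [hmvt c hcm x ⟨hcm.1.trans hx.1, hx.2⟩ hx.1, hr h]
  have hleft : ‖∫ x in a..c, cexp (I * (θ x : ℂ))‖ ≤ 4 / √μ := by
    rcases hcm.1.eq_or_lt with h | h
    · simpa [h] using h4
    have hrefl : ∫ x in a..c, cexp (I * (θ x : ℂ)) =
        ∫ x in -c..-a, cexp (I * (θ (-x) : ℂ)) := by
      rw [intervalIntegral.integral_comp_neg (fun x => cexp (I * (θ x : ℂ))), neg_neg, neg_neg]
    rw [hrefl]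
    refine norm_integral_cexp_le_of_linear_le_deriv (θ := fun x => θ (-x))
      (θ' := fun x => -θ' (-x)) (θ'' := fun x => θ'' (-x)) (neg_le_neg h.le) hμ
      (fun x => ?_) (fun x => ?_) (by fun_prop) (fun x hx => ?_) fun x hx => ?_
    · simpa using! (hθ (-x)).scomp x (hasDerivAt_neg x)
    · simpa using! ((hθ' (-x)).scomp x (hasDerivAt_neg x)).neg
    · have hx' : -x ∈ Icc a b := ⟨by linarith [hx.2], by linarith [hx.1, hcm.2]⟩
      linarith [hmvt (-x) hx' c hcm (by linarith [hx.1]), hl h]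
    · exact hpos (-x) ⟨by linarith [hx.2], by linarith [hx.1, hcm.2]⟩
  rw [← intervalIntegral.integral_add_adjacent_intervals
    (hci.intervalIntegrable a c) (hci.intervalIntegrable c b)]
  exact (norm_add_le _ _).trans ((add_le_add hleft hright).trans (le_of_eq (by ring)))

/-- Bounds for primitives pass to integrals against an amplitude of bounded variation. -/
lemma norm_integral_mul_le_of_norm_primitive_le {g : ℝ → ℂ} {ψ ψ' : ℝ → ℝ} {a b B V : ℝ}
    (hab : a ≤ b) (hg : Continuous g) (hψ : ∀ x, HasDerivAt ψ (ψ' x) x) (hψ' : Continuous ψ')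
    (hB : ∀ q ∈ Icc a b, ‖∫ x in a..q, g x‖ ≤ B) (hb : |ψ b| ≤ 1)
    (hV : ∫ x in a..b, |ψ' x| ≤ V) :
    ‖∫ x in a..b, g x * (ψ x : ℂ)‖ ≤ B * (1 + V) := by
  have hB0 : 0 ≤ B := (norm_nonneg _).trans (hB b (right_mem_Icc.2 hab))
  have hG : ∀ x, HasDerivAt (fun q => ∫ x in a..q, g x) (g x) x := fun x =>
    hg.integral_hasStrictDerivAt a x |>.hasDerivAt
  have hGc : Continuous fun q => ∫ x in a..q, g x :=
    continuous_iff_continuousAt.2 fun x => (hG x).continuousAt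
  have hparts := intervalIntegral.integral_mul_deriv_eq_deriv_mul (a := a) (b := b)
    (u := fun x => (ψ x : ℂ)) (u' := fun x => (ψ' x : ℂ)) (fun x _ => (hψ x).ofReal_comp)
    (fun x _ => hG x) (by apply Continuous.intervalIntegrable; fun_prop)
    (hg.intervalIntegrable _ _)
  simp only [intervalIntegral.integral_same, mul_zero, sub_zero] at hparts
  simp_rw [mul_comm (g _)]
  rw [hparts]
  have h1 : ‖(ψ b : ℂ) * ∫ x in a..b, g x‖ ≤ 1 * B := by
    rw [norm_mul, Complex.norm_real]
    exact mul_le_mul hb (hB b (right_mem_Icc.2 hab)) (norm_nonneg _) zero_le_one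
  have h2 : ‖∫ x in a..b, (ψ' x : ℂ) * ∫ y in a..x, g y‖ ≤ V * B := by
    refine (intervalIntegral.norm_integral_le_of_norm_le hab (g := fun x => |ψ' x| * B)
      (Eventually.of_forall fun x hx => ?_)
      (by apply Continuous.intervalIntegrable; fun_prop)).trans ?_
    · rw [norm_mul, Complex.norm_real]
      exact mul_le_mul_of_nonneg_left (hB x (Ioc_subset_Icc_self hx)) (abs_nonneg _)
    · rw [intervalIntegral.integral_mul_const]
      exact mul_le_mul_of_nonneg_right hV hB0
  exact (norm_sub_le _ _).trans ((add_le_add h1 h2).trans (le_of_eq (by ring)))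

/-- A multiplier whose truncated kernels are bounded by `B` maps `L¹` to `L^∞` with norm at
most `B`. -/
lemma norm_integral_multiplier_le {k : ℝ → ℂ} (hk : Continuous k) {K B : ℝ}
    (hK : ∀ ξ, ‖k ξ‖ ≤ K)
    (hB : ∀ᶠ R : ℝ in atTop, ∀ z : ℝ, ‖∫ ξ in -R..R, cexp (I * ((z * ξ : ℝ) : ℂ)) * k ξ‖ ≤ B)
    {f : ℝ → ℂ} (hf : Integrable f) (x : ℝ) :
    ‖∫ ξ : ℝ, cexp (I * ((x * ξ : ℝ) : ℂ)) * k ξ *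
      (∫ y : ℝ, cexp (-(I * ((y * ξ : ℝ) : ℂ))) * f y)‖ ≤ B * ∫ y : ℝ, ‖f y‖ := by
  set F : ℝ → ℂ := fun ξ => cexp (I * ((x * ξ : ℝ) : ℂ)) * k ξ *
      (∫ y : ℝ, cexp (-(I * ((y * ξ : ℝ) : ℂ))) * f y) with hF
  have hB0 : 0 ≤ B := by
    obtain ⟨R, hR⟩ := hB.exists
    exact (norm_nonneg _).trans (hR 0)
  by_cases hint : Integrable F
  swap
  · rw [integral_undef hint, norm_zero]
    exact mul_nonneg hB0 (integral_nonneg fun _ => norm_nonneg _)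
  have hlim := intervalIntegral_tendsto_integral hint tendsto_neg_atTop_atBot tendsto_id
  refine le_of_tendsto hlim.norm ?_
  filter_upwards [hB] with R hR
  have hswap : ∫ ξ in -R..R, F ξ =
      ∫ y, (∫ ξ in -R..R, cexp (I * (((x - y) * ξ : ℝ) : ℂ)) * k ξ) * f y := by
    have hexp : ∀ ξ, F ξ = ∫ y, cexp (I * (((x - y) * ξ : ℝ) : ℂ)) * k ξ * f y := by
      intro ξ
      simp only [hF]
      rw [← integral_const_mul]
      refine integral_congr_ae (Eventually.of_forall fun y => ?_)
      have : cexp (I * (((x - y) * ξ : ℝ) : ℂ)) =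
          cexp (I * ((x * ξ : ℝ) : ℂ)) * cexp (-(I * ((y * ξ : ℝ) : ℂ))) := by
        rw [← Complex.exp_add]; congr 1; push_cast; ring
      simp only [this]; ring
    simp_rw [hexp]
    rw [intervalIntegral_integral_swap]
    · simp_rw [intervalIntegral.integral_mul_const]
    · have h1 : Integrable (fun z : ℝ × ℝ => (1 : ℂ) * f z.2)
          ((volume.restrict (uIoc (-R) R)).prod volume) :=
        Integrable.mul_prod (f := fun _ => (1 : ℂ))
          (continuous_const.intervalIntegrable (μ := volume) _ _).def' hf
      simp only [one_mul] at h1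
      refine h1.bdd_mul (c := K)
        (f := fun z : ℝ × ℝ => cexp (I * (((x - z.2) * z.1 : ℝ) : ℂ)) * k z.1) ?_ ?_
      · apply Continuous.aestronglyMeasurable; fun_prop
      · refine Eventually.of_forall fun z => ?_
        rw [norm_mul, norm_exp_I_mul_ofReal, one_mul]
        exact hK _
  simp only [id]
  rw [hswap, ← integral_const_mul]
  refine norm_integral_le_of_norm_le (hf.norm.const_mul B) (Eventually.of_forall fun y => ?_)
  rw [norm_mul]
  exact mul_le_mul_of_nonneg_right (hR _) (norm_nonneg _)

lemma hasDerivAt_sqrt_pow_four_add {m : ℝ} (hm : m ≠ 0) (ξ : ℝ) :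
    HasDerivAt (fun ξ : ℝ => √(ξ ^ 4 + m ^ 2)) (2 * ξ ^ 3 / √(ξ ^ 4 + m ^ 2)) ξ := by
  have hpos : 0 < ξ ^ 4 + m ^ 2 := by positivity
  convert! ((hasDerivAt_pow 4 ξ).add_const (m ^ 2)).sqrt hpos.ne' using 1
  have := (Real.sqrt_pos.2 hpos).ne'
  field_simp
  push_cast
  ring

lemma hasDerivAt_deriv_sqrt_pow_four_add {m : ℝ} (hm : m ≠ 0) (ξ : ℝ) :
    HasDerivAt (fun ξ : ℝ => 2 * ξ ^ 3 / √(ξ ^ 4 + m ^ 2))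
      (2 * ξ ^ 2 * (ξ ^ 4 + 3 * m ^ 2) / √(ξ ^ 4 + m ^ 2) ^ 3) ξ := by
  have hpos : 0 < ξ ^ 4 + m ^ 2 := by positivity
  have hne := (Real.sqrt_pos.2 hpos).ne'
  convert! ((hasDerivAt_pow 3 ξ).const_mul 2).fun_div (hasDerivAt_sqrt_pow_four_add hm ξ) hne
    using 1
  have hsq : √(ξ ^ 4 + m ^ 2) ^ 2 = ξ ^ 4 + m ^ 2 := Real.sq_sqrt hpos.le
  field_simp
  rw [hsq]
  push_cast
  ring

lemma le_deriv_deriv_sqrt_pow_four_add {m : ℝ} (hm : m ≠ 0) {p ξ : ℝ} (hp : 0 < p) (h : p ≤ ξ) :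
    2 * p ^ 2 / (p ^ 2 + |m|) ≤ 2 * ξ ^ 2 * (ξ ^ 4 + 3 * m ^ 2) / √(ξ ^ 4 + m ^ 2) ^ 3 := by
  have hξ : 0 < ξ := hp.trans_le h
  have hm' : 0 < |m| := abs_pos.2 hm
  have hpos : 0 < ξ ^ 4 + m ^ 2 := by positivity
  have hw := Real.sqrt_pos.2 hpos
  have hsq : √(ξ ^ 4 + m ^ 2) ^ 2 = ξ ^ 4 + m ^ 2 := Real.sq_sqrt hpos.le
  have hle : √(ξ ^ 4 + m ^ 2) ≤ ξ ^ 2 + |m| := by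
    refine Real.sqrt_le_iff.2 ⟨by positivity, ?_⟩
    nlinarith [sq_abs m, mul_pos (pow_pos hξ 2) hm']
  calc 2 * p ^ 2 / (p ^ 2 + |m|) ≤ 2 * ξ ^ 2 / (ξ ^ 2 + |m|) := by
        rw [div_le_div_iff₀ (by positivity) (by positivity)]
        nlinarith [mul_le_mul_of_nonneg_right (pow_le_pow_left₀ hp.le h 2) hm'.le]
    _ ≤ 2 * ξ ^ 2 / √(ξ ^ 4 + m ^ 2) := by gcongr
    _ = 2 * ξ ^ 2 * √(ξ ^ 4 + m ^ 2) ^ 2 / √(ξ ^ 4 + m ^ 2) ^ 3 := by field_simp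
    _ ≤ _ := by
        rw [hsq]
        gcongr
        nlinarith [sq_nonneg m]

lemma norm_integral_cexp_neg (θ : ℝ → ℝ) (a b : ℝ) :
    ‖∫ x in a..b, cexp (I * ((-θ x : ℝ) : ℂ))‖ = ‖∫ x in a..b, cexp (I * (θ x : ℂ))‖ := by
  have h : ∀ x, cexp (I * ((-θ x : ℝ) : ℂ)) = (starRingEnd ℂ) (cexp (I * (θ x : ℂ))) := by
    intro x
    rw [← Complex.exp_conj]
    simp
  simp_rw [h, intervalIntegral.norm_intervalIntegral_eq, integral_conj, RCLike.norm_conj]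

/-- Oscillatory integral bound for the phase `y ξ + s √(ξ⁴ + m²)` away from `ξ = 0`. -/
lemma norm_integral_cexp_phase_le {m : ℝ} (hm : m ≠ 0) {s p q : ℝ} (hs : s ≠ 0) (hp : 0 < p)
    (hpq : p ≤ q) (y : ℝ) :
    ‖∫ ξ in p..q, cexp (I * ((y * ξ + s * √(ξ ^ 4 + m ^ 2) : ℝ) : ℂ))‖ ≤
      8 / √(|s| * (2 * p ^ 2 / (p ^ 2 + |m|))) := by
  have key : ∀ s : ℝ, 0 < s → ∀ y : ℝ,
      ‖∫ ξ in p..q, cexp (I * ((y * ξ + s * √(ξ ^ 4 + m ^ 2) : ℝ) : ℂ))‖ ≤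
        8 / √(s * (2 * p ^ 2 / (p ^ 2 + |m|))) := by
    intro s hs y
    refine norm_integral_cexp_le_of_le_deriv_deriv hpq (by positivity)
      (fun ξ => ((hasDerivAt_id' ξ).const_mul y).add
        ((hasDerivAt_sqrt_pow_four_add hm ξ).const_mul s))
      (fun ξ => ((hasDerivAt_deriv_sqrt_pow_four_add hm ξ).const_mul s).const_add _) ?_ ?_
    · refine continuous_const.mul (Continuous.div (by fun_prop) (by fun_prop) fun ξ => ?_)
      positivity
    · exact fun ξ hξ =>
        mul_le_mul_of_nonneg_left (le_deriv_deriv_sqrt_pow_four_add hm hp hξ.1) hs.le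
  rcases hs.lt_or_gt with h | h
  · have := key (-s) (neg_pos.2 h) (-y)
    rw [abs_of_neg h, ← norm_integral_cexp_neg]
    convert! this using 6
    ring_nf
  · rw [abs_of_pos h]
    exact key s h y

lemma norm_integral_cexp_phase_low_le {ρ : ℝ} {m : ℝ} (hm : m ≠ 0) {s q : ℝ}
    (hs : s ≠ 0) (hq : q ∈ Icc 0 ρ) (y : ℝ) :
    ‖∫ ξ in (0 : ℝ)..q, cexp (I * ((y * ξ + s * √(ξ ^ 4 + m ^ 2) : ℝ) : ℂ))‖ ≤
      (1 + 8 * √(1 + ρ ^ 2)) * (1 + |m|) ^ ((1 : ℝ) / 2) * |s| ^ (-(1 / 4) : ℝ) := by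
  have hs' : 0 < |s| := abs_pos.2 hs
  have hm1 : 1 ≤ 1 + |m| := by linarith [abs_nonneg m]
  have hm0 : 0 < 1 + |m| := by linarith
  set d : ℝ := (1 + |m|) ^ ((1 : ℝ) / 4) * |s| ^ (-(1 / 4) : ℝ) with hd
  have hdpos : 0 < d := by positivity
  have hd4 : d ^ 4 * |s| = 1 + |m| := by
    rw [hd, mul_pow, ← Real.rpow_natCast, ← Real.rpow_natCast, ← Real.rpow_mul hm0.le,
      ← Real.rpow_mul hs'.le]
    norm_num [Real.rpow_neg_one, hs'.ne']
  have hbound : ‖∫ ξ in (0 : ℝ)..q, cexp (I * ((y * ξ + s * √(ξ ^ 4 + m ^ 2) : ℝ) : ℂ))‖ ≤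
      (1 + 8 * √(1 + ρ ^ 2)) * d := by
    rcases le_total q d with h | h
    · refine (norm_integral_cexp_le hq.1).trans ?_
      nlinarith [mul_nonneg (Real.sqrt_nonneg (1 + ρ ^ 2)) hdpos.le]
    · have hci : Continuous fun ξ : ℝ =>
          cexp (I * ((y * ξ + s * √(ξ ^ 4 + m ^ 2) : ℝ) : ℂ)) := by fun_prop
      rw [← intervalIntegral.integral_add_adjacent_intervals
        (hci.intervalIntegrable 0 d) (hci.intervalIntegrable d q)]
      have h1 := norm_integral_cexp_le (θ := fun ξ => y * ξ + s * √(ξ ^ 4 + m ^ 2)) hdpos.le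
      have h2 := norm_integral_cexp_phase_le hm hs hdpos h y
      have h3 : 8 / √(|s| * (2 * d ^ 2 / (d ^ 2 + |m|))) ≤ 8 * √(1 + ρ ^ 2) * d := by
        rw [div_le_iff₀ (by positivity), mul_assoc, mul_assoc]
        refine le_mul_of_one_le_right (by norm_num) ?_
        rw [← Real.sqrt_sq hdpos.le, ← Real.sqrt_mul (by positivity),
          ← Real.sqrt_mul (by positivity), Real.sqrt_sq hdpos.le, Real.one_le_sqrt]
        have e : (1 + ρ ^ 2) * (d ^ 2 * (|s| * (2 * d ^ 2 / (d ^ 2 + |m|)))) =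
            2 * ((1 + ρ ^ 2) * (1 + |m|)) / (d ^ 2 + |m|) := by
          rw [← hd4]; ring
        rw [e, one_le_div (by positivity)]
        have : d ^ 2 ≤ ρ ^ 2 := pow_le_pow_left₀ hdpos.le (h.trans hq.2) 2
        nlinarith [abs_nonneg m, sq_nonneg ρ, mul_nonneg (sq_nonneg ρ) (abs_nonneg m)]
      refine (norm_add_le _ _).trans ((add_le_add h1 (h2.trans h3)).trans (le_of_eq (by ring)))
  refine hbound.trans ?_
  rw [mul_assoc]
  refine mul_le_mul_of_nonneg_left ?_ (by positivity)
  rw [hd]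
  exact mul_le_mul_of_nonneg_right (Real.rpow_le_rpow_of_exponent_le hm1 (by norm_num))
    (by positivity)

lemma norm_integral_cexp_phase_high_le {r : ℝ} (hr : 0 < r) {m : ℝ} (hm : m ≠ 0) {s q : ℝ}
    (hs : s ≠ 0) (hq : r ≤ q) (y : ℝ) :
    ‖∫ ξ in r..q, cexp (I * ((y * ξ + s * √(ξ ^ 4 + m ^ 2) : ℝ) : ℂ))‖ ≤
      8 * (1 + 1 / r) * (1 + |m|) * |s| ^ (-(1 / 2) : ℝ) := by
  have hs' : 0 < |s| := abs_pos.2 hs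
  have hm' : 0 < |m| := abs_pos.2 hm
  refine (norm_integral_cexp_phase_le hm hs hr hq y).trans ?_
  rw [Real.sqrt_mul hs'.le, Real.rpow_neg hs'.le, ← Real.sqrt_eq_rpow, div_le_iff₀ (by positivity)]
  have hss : 0 < √|s| := Real.sqrt_pos.2 hs'
  have e : 8 * (1 + 1 / r) * (1 + |m|) * (√|s|)⁻¹ * (√|s| * √(2 * r ^ 2 / (r ^ 2 + |m|))) =
      8 * ((1 + 1 / r) * (1 + |m|) * √(2 * r ^ 2 / (r ^ 2 + |m|))) := by
    field_simp
  rw [e]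
  refine le_mul_of_one_le_right (by norm_num) ?_
  have hA : 0 ≤ (1 + 1 / r) * (1 + |m|) := by positivity
  rw [← Real.sqrt_sq hA, ← Real.sqrt_mul (sq_nonneg _), Real.one_le_sqrt]
  have e2 : ((1 + 1 / r) * (1 + |m|)) ^ 2 * (2 * r ^ 2 / (r ^ 2 + |m|)) =
      2 * ((r + 1) * (1 + |m|)) ^ 2 / (r ^ 2 + |m|) := by
    field_simp
  rw [e2, one_le_div (by positivity)]
  have h1 : r ^ 2 + |m| ≤ (r + 1) ^ 2 * (1 + |m|) := by
    nlinarith [mul_pos hr hm', sq_nonneg r, mul_pos (pow_pos hr 2) hm']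
  have h2 : (r + 1) ^ 2 * (1 + |m|) ≤ ((r + 1) * (1 + |m|)) ^ 2 := by
    rw [mul_pow]; gcongr; nlinarith
  nlinarith [sq_nonneg ((r + 1) * (1 + |m|))]

lemma norm_integral_cos_mul_le {ψ : ℝ → ℝ} (hψ : Continuous ψ) {t m R B : ℝ}
    (hB : ∀ s : ℝ, |s| = |t| → ∀ y : ℝ, ‖∫ ξ in (0 : ℝ)..R,
      cexp (I * ((y * ξ + s * √(ξ ^ 4 + m ^ 2) : ℝ) : ℂ)) * (ψ ξ : ℂ)‖ ≤ B) (y : ℝ) :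
    ‖∫ ξ in (0 : ℝ)..R, cexp (I * ((y * ξ : ℝ) : ℂ)) *
      (((Real.cos (t * √(ξ ^ 4 + m ^ 2)) : ℝ) : ℂ) * (ψ ξ : ℂ))‖ ≤ B := by
  have h1 := hB t rfl y
  have h2 := hB (-t) (abs_neg t) y
  have hcont : ∀ s : ℝ, Continuous fun ξ : ℝ =>
      cexp (I * ((y * ξ + s * √(ξ ^ 4 + m ^ 2) : ℝ) : ℂ)) * (ψ ξ : ℂ) := fun s => by fun_prop
  have e : ∀ ξ : ℝ, cexp (I * ((y * ξ : ℝ) : ℂ)) *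
      (((Real.cos (t * √(ξ ^ 4 + m ^ 2)) : ℝ) : ℂ) * (ψ ξ : ℂ)) =
      (1 / 2 : ℂ) * (cexp (I * ((y * ξ + t * √(ξ ^ 4 + m ^ 2) : ℝ) : ℂ)) * (ψ ξ : ℂ) +
        cexp (I * ((y * ξ + -t * √(ξ ^ 4 + m ^ 2) : ℝ) : ℂ)) * (ψ ξ : ℂ)) := by
    intro ξ
    have e1 : ∀ s : ℝ, cexp (I * ((y * ξ + s * √(ξ ^ 4 + m ^ 2) : ℝ) : ℂ)) =
        cexp (I * ((y * ξ : ℝ) : ℂ)) * cexp (((s * √(ξ ^ 4 + m ^ 2) : ℝ) : ℂ) * I) := fun s => by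
      rw [← Complex.exp_add]; congr 1; push_cast; ring
    rw [e1, e1, ofReal_cos, Complex.cos, neg_mul t, ofReal_neg]
    ring
  simp_rw [e]
  rw [intervalIntegral.integral_const_mul, intervalIntegral.integral_add
    ((hcont t).intervalIntegrable _ _) ((hcont (-t)).intervalIntegrable _ _), norm_mul]
  have h3 : ‖(1 / 2 : ℂ)‖ = 1 / 2 := by norm_num
  rw [h3]
  linarith [norm_add_le (∫ ξ in (0 : ℝ)..R,
      cexp (I * ((y * ξ + t * √(ξ ^ 4 + m ^ 2) : ℝ) : ℂ)) * (ψ ξ : ℂ)) (∫ ξ in (0 : ℝ)..R,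
      cexp (I * ((y * ξ + -t * √(ξ ^ 4 + m ^ 2) : ℝ) : ℂ)) * (ψ ξ : ℂ))]

/-- Dispersive bound for an even amplitude `ψ`, reduced to half-line oscillatory integrals. -/
lemma norm_cos_multiplier_le {ψ : ℝ → ℝ} (hψ : Continuous ψ) (heven : ∀ ξ, ψ (-ξ) = ψ ξ)
    {K t m B : ℝ} (hK : ∀ ξ, |ψ ξ| ≤ K)
    (hB : ∀ᶠ R : ℝ in atTop, ∀ s : ℝ, |s| = |t| → ∀ y : ℝ, ‖∫ ξ in (0 : ℝ)..R,
      cexp (I * ((y * ξ + s * √(ξ ^ 4 + m ^ 2) : ℝ) : ℂ)) * (ψ ξ : ℂ)‖ ≤ B)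
    {f : ℝ → ℂ} (hf : Integrable f) (x : ℝ) :
    ‖(2 * Real.pi)⁻¹ • ∫ ξ : ℝ, cexp (I * ((x * ξ : ℝ) : ℂ))
      * ((Real.cos (t * √(ξ ^ 4 + m ^ 2)) : ℝ) : ℂ) * (ψ ξ : ℂ)
      * (∫ y : ℝ, cexp (-(I * ((y * ξ : ℝ) : ℂ))) * f y)‖ ≤ 2 * B * ∫ y : ℝ, ‖f y‖ := by
  set k : ℝ → ℂ := fun ξ => ((Real.cos (t * √(ξ ^ 4 + m ^ 2)) : ℝ) : ℂ) * (ψ ξ : ℂ) with hk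
  have hkc : Continuous k := by fun_prop
  have hkeven : ∀ ξ, k (-ξ) = k ξ := fun ξ => by simp only [hk, heven,
    show (-ξ) ^ 4 = ξ ^ 4 by ring]
  have hkK : ∀ ξ, ‖k ξ‖ ≤ K := fun ξ => by
    rw [hk, norm_mul, Complex.norm_real, Complex.norm_real]
    refine le_trans ?_ (hK ξ)
    exact mul_le_of_le_one_left (norm_nonneg _) (Real.abs_cos_le_one _)
  have hkB : ∀ᶠ R : ℝ in atTop, ∀ z : ℝ,
      ‖∫ ξ in -R..R, cexp (I * ((z * ξ : ℝ) : ℂ)) * k ξ‖ ≤ 2 * B := by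
    filter_upwards [hB] with R hR z
    have hc : Continuous fun ξ : ℝ => cexp (I * ((z * ξ : ℝ) : ℂ)) * k ξ := by fun_prop
    have hrefl : ∫ ξ in -R..0, cexp (I * ((z * ξ : ℝ) : ℂ)) * k ξ =
        ∫ ξ in (0 : ℝ)..R, cexp (I * ((-z * ξ : ℝ) : ℂ)) * k ξ := by
      have := intervalIntegral.integral_comp_neg (a := 0) (b := R)
        (fun ξ : ℝ => cexp (I * ((z * ξ : ℝ) : ℂ)) * k ξ)
      rw [neg_zero] at this
      rw [← this]
      simp_rw [hkeven, mul_neg, neg_mul]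
    rw [← intervalIntegral.integral_add_adjacent_intervals
      (hc.intervalIntegrable (-R) 0) (hc.intervalIntegrable 0 R), hrefl]
    refine (norm_add_le _ _).trans ((add_le_add (norm_integral_cos_mul_le hψ hR (-z))
      (norm_integral_cos_mul_le hψ hR z)).trans (le_of_eq (by ring)))
  have hmain := norm_integral_multiplier_le hkc hkK hkB hf x
  have hpi : (2 * Real.pi)⁻¹ ≤ 1 := inv_le_one_of_one_le₀ (by linarith [Real.pi_gt_three])
  rw [norm_smul, Real.norm_of_nonneg (by positivity)]
  refine (mul_le_of_le_one_left (norm_nonneg _) hpi).trans ?_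
  simpa only [hk, mul_assoc] using hmain

/-- Half-line bound for an amplitude supported in `[-ρ, ρ]`. -/
lemma norm_integral_cexp_phase_mul_low_le {a : ℝ → ℝ} (ha : ContDiff ℝ 1 a)
    (hac : HasCompactSupport a) {ρ R : ℝ} (hρ : 0 ≤ ρ) (hρa : ∀ ξ, ρ ≤ ξ → a ξ = 0) (hR : ρ ≤ R)
    {m s : ℝ} (hm : m ≠ 0) (hs : s ≠ 0) (y : ℝ) :
    ‖∫ ξ in (0 : ℝ)..R, cexp (I * ((y * ξ + s * √(ξ ^ 4 + m ^ 2) : ℝ) : ℂ)) * (a ξ : ℂ)‖ ≤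
      (1 + 8 * √(1 + ρ ^ 2)) * (1 + |m|) ^ ((1 : ℝ) / 2) * |s| ^ (-(1 / 4) : ℝ) *
        (1 + ∫ ξ, |deriv a ξ|) := by
  have hac' : Continuous (deriv a) := ha.continuous_deriv le_rfl
  have haC : Continuous a := ha.continuous
  have hint : Integrable fun ξ => |deriv a ξ| :=
    (hac'.integrable_of_hasCompactSupport hac.deriv).abs
  have hg : Continuous fun ξ : ℝ => cexp (I * ((y * ξ + s * √(ξ ^ 4 + m ^ 2) : ℝ) : ℂ)) := by
    fun_prop
  have hc : Continuous fun ξ : ℝ =>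
      cexp (I * ((y * ξ + s * √(ξ ^ 4 + m ^ 2) : ℝ) : ℂ)) * (a ξ : ℂ) := by fun_prop
  have htail : ∫ ξ in ρ..R,
      cexp (I * ((y * ξ + s * √(ξ ^ 4 + m ^ 2) : ℝ) : ℂ)) * (a ξ : ℂ) = 0 := by
    refine intervalIntegral.integral_zero_ae (Eventually.of_forall fun ξ hξ => ?_)
    rw [uIoc_of_le hR] at hξ
    rw [hρa ξ hξ.1.le, ofReal_zero, mul_zero]
  rw [← intervalIntegral.integral_add_adjacent_intervals
    (hc.intervalIntegrable 0 ρ) (hc.intervalIntegrable ρ R), htail, add_zero]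
  refine norm_integral_mul_le_of_norm_primitive_le hρ hg
    (fun ξ => (ha.differentiable one_ne_zero ξ).hasDerivAt) hac'
    (fun q hq => norm_integral_cexp_phase_low_le hm hs hq y) (by simp [hρa ρ le_rfl]) ?_
  rw [intervalIntegral.integral_of_le hρ]
  exact setIntegral_le_integral hint (Eventually.of_forall fun _ => abs_nonneg _)

/-- Half-line bound for an amplitude `1 - a` supported away from `0`. -/
lemma norm_integral_cexp_phase_mul_high_le {a : ℝ → ℝ} (ha : ContDiff ℝ 1 a)
    (hac : HasCompactSupport a) {r ρ R : ℝ} (hr : 0 < r)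
    (hra : ∀ ξ ∈ Icc 0 r, a ξ = 1) (hρa : ∀ ξ, ρ ≤ ξ → a ξ = 0) (hrR : r ≤ R) (hR : ρ ≤ R)
    {m s : ℝ} (hm : m ≠ 0) (hs : s ≠ 0) (y : ℝ) :
    ‖∫ ξ in (0 : ℝ)..R,
        cexp (I * ((y * ξ + s * √(ξ ^ 4 + m ^ 2) : ℝ) : ℂ)) * ((1 - a ξ : ℝ) : ℂ)‖ ≤
      8 * (1 + 1 / r) * (1 + |m|) * |s| ^ (-(1 / 2) : ℝ) * (1 + ∫ ξ, |deriv a ξ|) := by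
  have hac' : Continuous (deriv a) := ha.continuous_deriv le_rfl
  have haC : Continuous a := ha.continuous
  have hint : Integrable fun ξ => |deriv a ξ| :=
    (hac'.integrable_of_hasCompactSupport hac.deriv).abs
  have hg : Continuous fun ξ : ℝ => cexp (I * ((y * ξ + s * √(ξ ^ 4 + m ^ 2) : ℝ) : ℂ)) := by
    fun_prop
  have hc : Continuous fun ξ : ℝ =>
      cexp (I * ((y * ξ + s * √(ξ ^ 4 + m ^ 2) : ℝ) : ℂ)) * ((1 - a ξ : ℝ) : ℂ) := by fun_prop
  have hhead : ∫ ξ in (0 : ℝ)..r,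
      cexp (I * ((y * ξ + s * √(ξ ^ 4 + m ^ 2) : ℝ) : ℂ)) * ((1 - a ξ : ℝ) : ℂ) = 0 := by
    refine intervalIntegral.integral_zero_ae (Eventually.of_forall fun ξ hξ => ?_)
    rw [uIoc_of_le hr.le] at hξ
    rw [hra ξ (Ioc_subset_Icc_self hξ), sub_self, ofReal_zero, mul_zero]
  rw [← intervalIntegral.integral_add_adjacent_intervals
    (hc.intervalIntegrable 0 r) (hc.intervalIntegrable r R), hhead, zero_add]
  refine norm_integral_mul_le_of_norm_primitive_le hrR hg
    (fun ξ => (ha.differentiable one_ne_zero ξ).hasDerivAt.const_sub 1) hac'.neg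
    (fun q hq => norm_integral_cexp_phase_high_le hr hm hs hq.1 y) (by simp [hρa R hR]) ?_
  simp_rw [abs_neg]
  rw [intervalIntegral.integral_of_le hrR]
  exact setIntegral_le_integral hint (Eventually.of_forall fun _ => abs_nonneg _)

/-- Free massive estimates for `cos(t√(Δ²+m²))` (Proposition 2.4):
`‖cos(t√(Δ²+m²)) χ₁(Δ²)‖_{L¹→L^∞} ≲ ⟨m⟩^{1/2} |t|^{-1/4}` and
`‖cos(t√(Δ²+m²)) χ₂(Δ²)‖_{L¹→L^∞} ≲ ⟨m⟩ |t|^{-1/2}`, with `χ₂ = 1 - χ₁`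
and `⟨m⟩ = 1 + |m|`. -/
theorem stmt_11 (lam₀ : ℝ) (hlam₀ : 0 < lam₀)
    (χ₁ : ℝ → ℝ) (hχ₁ : ContDiff ℝ (⊤ : ℕ∞) χ₁) (hχ₁c : HasCompactSupport χ₁)
    (hχ₁one : ∀ lam : ℝ, |lam| ≤ lam₀ → χ₁ lam = 1)
    (hχ₁zero : ∀ lam : ℝ, 2 * lam₀ ≤ |lam| → χ₁ lam = 0) :
    ∃ C > 0, ∀ m : ℝ, m ≠ 0 → ∀ t : ℝ, t ≠ 0 → ∀ f : SchwartzMap ℝ ℂ, ∀ x : ℝ,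
      (‖(2 * Real.pi)⁻¹ • ∫ ξ : ℝ,
          Complex.exp (Complex.I * ((x * ξ : ℝ) : ℂ))
          * ((Real.cos (t * Real.sqrt (ξ^4 + m^2)) : ℝ) : ℂ)
          * ((χ₁ (ξ^4) : ℝ) : ℂ)
          * (∫ y : ℝ, Complex.exp (-(Complex.I * ((y * ξ : ℝ) : ℂ))) * f y)‖
        ≤ C * (1 + |m|) ^ ((1:ℝ)/2) * |t| ^ (-(1/4) : ℝ) * ∫ y : ℝ, ‖f y‖) ∧
      (‖(2 * Real.pi)⁻¹ • ∫ ξ : ℝ,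
          Complex.exp (Complex.I * ((x * ξ : ℝ) : ℂ))
          * ((Real.cos (t * Real.sqrt (ξ^4 + m^2)) : ℝ) : ℂ)
          * ((1 - χ₁ (ξ^4) : ℝ) : ℂ)
          * (∫ y : ℝ, Complex.exp (-(Complex.I * ((y * ξ : ℝ) : ℂ))) * f y)‖
        ≤ C * (1 + |m|) * |t| ^ (-(1/2) : ℝ) * ∫ y : ℝ, ‖f y‖) := by
  obtain ⟨M, hM⟩ := hχ₁c.exists_bound_of_continuous hχ₁.continuous
  set a : ℝ → ℝ := fun ξ => χ₁ (ξ ^ 4) with ha_def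
  have ha : ContDiff ℝ 1 a :=
    (hχ₁.of_le (by exact_mod_cast le_top)).comp (contDiff_id.pow 4)
  have heven : ∀ ξ, a (-ξ) = a ξ := fun ξ => by
    simp only [ha_def, show (-ξ) ^ 4 = ξ ^ 4 by ring]
  set ρ : ℝ := 1 + 2 * lam₀ with hρ_def
  have hρ1 : 1 ≤ ρ := by linarith
  have hρa : ∀ ξ, ρ ≤ ξ → a ξ = 0 := fun ξ hξ => by
    refine hχ₁zero _ (le_trans ?_ (le_abs_self _))
    linarith [le_self_pow₀ (hρ1.trans hξ) four_ne_zero]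
  have hac : HasCompactSupport a := by
    refine HasCompactSupport.intro (isCompact_Icc (a := -ρ) (b := ρ)) fun ξ hξ => ?_
    by_contra hne
    refine hξ ⟨?_, ?_⟩
    · by_contra! h
      exact hne (by rw [← heven]; exact hρa _ (by linarith))
    · by_contra! h
      exact hne (hρa _ h.le)
  set r : ℝ := min 1 lam₀ with hr_def
  have hr : 0 < r := lt_min one_pos hlam₀
  have hra : ∀ ξ ∈ Icc 0 r, a ξ = 1 := fun ξ hξ => by
    refine hχ₁one _ ?_
    rw [abs_of_nonneg (pow_nonneg hξ.1 4)]
    exact (pow_le_of_le_one hξ.1 (hξ.2.trans (min_le_left _ _)) four_ne_zero).trans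
      (hξ.2.trans (min_le_right _ _))
  set V : ℝ := ∫ ξ, |deriv a ξ|
  have hV : 0 ≤ V := integral_nonneg fun _ => abs_nonneg _
  set K₁ : ℝ := 2 * ((1 + 8 * √(1 + ρ ^ 2)) * (1 + V))
  set K₂ : ℝ := 2 * (8 * (1 + 1 / r) * (1 + V))
  have hK₁ : 0 < K₁ := by positivity
  have hK₂ : 0 < K₂ := by positivity
  refine ⟨K₁ + K₂, by positivity, fun m hm t ht f x => ?_⟩
  have hne : ∀ {s : ℝ}, |s| = |t| → s ≠ 0 := fun h =>
    abs_pos.1 (h ▸ abs_pos.2 ht)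
  have hf0 : 0 ≤ ∫ y, ‖f y‖ := integral_nonneg fun _ => norm_nonneg _
  constructor
  · refine (norm_cos_multiplier_le (ψ := a) ha.continuous heven (K := M) (fun ξ => hM _)
      (B := (1 + 8 * √(1 + ρ ^ 2)) * (1 + |m|) ^ ((1 : ℝ) / 2) * |t| ^ (-(1 / 4) : ℝ) * (1 + V))
      ?_ f.integrable x).trans ?_
    · filter_upwards [eventually_ge_atTop ρ] with R hR s hs y
      rw [← hs]
      exact norm_integral_cexp_phase_mul_low_le ha hac (by linarith) hρa hR hm (hne hs) y
    · refine mul_le_mul_of_nonneg_right ?_ hf0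
      calc _ = K₁ * (1 + |m|) ^ ((1 : ℝ) / 2) * |t| ^ (-(1 / 4) : ℝ) := by ring
        _ ≤ _ := by gcongr; linarith
  · refine (norm_cos_multiplier_le (ψ := fun ξ => 1 - a ξ) (continuous_const.sub ha.continuous)
      (fun ξ => by rw [heven]) (K := 1 + M)
      (fun ξ => (abs_sub _ _).trans (by rw [abs_one]; exact add_le_add le_rfl (hM _)))
      (B := 8 * (1 + 1 / r) * (1 + |m|) * |t| ^ (-(1 / 2) : ℝ) * (1 + V))
      ?_ f.integrable x).trans ?_
    · filter_upwards [eventually_ge_atTop ρ, eventually_ge_atTop r] with R hR hrR s hs y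
      rw [← hs]
      exact norm_integral_cexp_phase_mul_high_le ha hac hr hra hρa hrR hR hm (hne hs) y
    · refine mul_le_mul_of_nonneg_right ?_ hf0
      calc _ = K₂ * (1 + |m|) * |t| ^ (-(1 / 2) : ℝ) := by ring
        _ ≤ _ := by gcongr; linarith
end

section
/- There exists C > 0, depending only on χ₁, such that for all m ≠ 0, all t ≠ 0 and all f ∈ 𝒮(ℝ): sup_{x ∈ ℝ} |(2π)^{−1} ∫_ℝ e^{ixξ} (sin(t√(ξ⁴+m²))/√(ξ⁴+m²)) χ₁(ξ⁴) f̂(ξ) dξ| ≤ C |m|^{−1} ⟨m⟩^{1/2} |t|^{−1/4} ‖f‖_{L¹(ℝ)} and sup_{x ∈ ℝ} |(2π)^{−1} ∫_ℝ e^{ixξ} (sin(t√(ξ⁴+m²))/√(ξ⁴+m²)) χ₂(ξ⁴) f̂(ξ) dξ| ≤ C (1 + 1/|m|) |t|^{−1/2} ‖f‖_{L¹(ℝ)}. In other words, ‖(sin(t√(Δ²+m²))/√(Δ²+m²)) χ₁(Δ²)‖_{L¹→L^∞} ≲ |m|^{−1} ⟨m⟩^{1/2} |t|^{−1/4} and ‖(sin(t√(Δ²+m²))/√(Δ²+m²))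 χ₂(Δ²)‖_{L¹→L^∞} ≲ (1 + 1/|m|) |t|^{−1/2}. -/
open MeasureTheory

/-- Van der Corput's second-derivative test with an amplitude. -/
theorem abs_integral_mul_sin_le {a b lam M : ℝ} (hab : a ≤ b) (hlam : 0 < lam)
    {A A' φ w w' : ℝ → ℝ}
    (hA : ∀ x ∈ Set.Icc a b, HasDerivAt A (A' x) x)
    (hφ : ∀ x ∈ Set.Icc a b, HasDerivAt φ (w x) x)
    (hw : ∀ x ∈ Set.Icc a b, HasDerivAt w (w' x) x)
    (hA' : ContinuousOn A' (Set.Icc a b)) (hw' : ContinuousOn w' (Set.Icc a b))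
    (hlow : ∀ x ∈ Set.Icc a b, lam ≤ w' x) (hM : ∀ x ∈ Set.Icc a b, |A x| ≤ M) :
    |∫ x in a..b, A x * Real.sin (φ x)| ≤
      ((2 * Real.pi + 1) * M + (∫ x in a..b, |A' x|) / 2) / √lam := by
  set s := √lam with hs
  have hs0 : 0 < s := Real.sqrt_pos.2 hlam
  have hss : s ^ 2 = lam := Real.sq_sqrt hlam.le
  rw [← hss] at hlow
  have hpos : ∀ y : ℝ, 0 < y ^ 2 + s ^ 2 := fun y => by positivity
  have hAc : ContinuousOn A (Set.Icc a b) := fun x hx => (hA x hx).continuousAt.continuousWithinAt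
  have hφc : ContinuousOn φ (Set.Icc a b) := fun x hx => (hφ x hx).continuousAt.continuousWithinAt
  have hwc : ContinuousOn w (Set.Icc a b) := fun x hx => (hw x hx).continuousAt.continuousWithinAt
  have hint : ∀ {f : ℝ → ℝ}, ContinuousOn f (Set.Icc a b) →
      IntervalIntegrable f volume a b := fun h => h.intervalIntegrable_of_Icc hab
  set H : ℝ → ℝ := fun x => A x * Real.cos (φ x) * (w x / (w x ^ 2 + s ^ 2)) with hH
  set R : ℝ → ℝ := fun x => A' x * Real.cos (φ x) * (w x / (w x ^ 2 + s ^ 2))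
    + A x * Real.cos (φ x) * ((s ^ 2 - w x ^ 2) / (w x ^ 2 + s ^ 2) ^ 2 * w' x)
    + A x * Real.sin (φ x) * (s ^ 2 / (w x ^ 2 + s ^ 2)) with hR
  have hRc : ContinuousOn R (Set.Icc a b) := by
    have h1 : ∀ x ∈ Set.Icc a b, w x ^ 2 + s ^ 2 ≠ 0 := fun x _ => (hpos _).ne'
    have h2 : ∀ x ∈ Set.Icc a b, (w x ^ 2 + s ^ 2) ^ 2 ≠ 0 := fun x _ => pow_ne_zero _ (hpos _).ne'
    fun_prop (disch := assumption)
  have hSc : ContinuousOn (fun x => A x * Real.sin (φ x)) (Set.Icc a b) := by fun_prop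
  have hderiv : ∀ x ∈ Set.uIcc a b, HasDerivAt H (R x - A x * Real.sin (φ x)) x := by
    intro x hx
    rw [Set.uIcc_of_le hab] at hx
    have h := ((hA x hx).mul (hφ x hx).cos).mul
      ((hw x hx).div (((hw x hx).pow 2).add_const (s ^ 2)) (hpos _).ne')
    refine h.congr_deriv ?_
    have := (hpos (w x)).ne'
    simp only [hR, Pi.mul_apply, Pi.div_apply, Pi.pow_apply]
    field_simp
    push_cast
    ring
  have hFTC := intervalIntegral.integral_eq_sub_of_hasDerivAt hderiv ((hint hRc).sub (hint hSc))
  rw [intervalIntegral.integral_sub (hint hRc) (hint hSc)] at hFTC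
  have hM0 : 0 ≤ M := (abs_nonneg _).trans (hM a ⟨le_rfl, hab⟩)
  have hg : ∀ y : ℝ, |y / (y ^ 2 + s ^ 2)| ≤ 1 / (2 * s) := by
    intro y
    rw [abs_div, abs_of_pos (hpos y), div_le_div_iff₀ (hpos y) (by positivity), ← sq_abs y]
    nlinarith [sq_nonneg (|y| - s)]
  have hHb : ∀ x ∈ Set.Icc a b, |H x| ≤ M / (2 * s) := by
    intro x hx
    have h1 := hM x hx
    have h2 := Real.abs_cos_le_one (φ x)
    rw [hH]
    simp only [abs_mul]
    calc |A x| * |Real.cos (φ x)| * |w x / (w x ^ 2 + s ^ 2)| ≤ M * 1 * (1 / (2 * s)) := by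
          gcongr
          exact hg _
      _ = _ := by ring
  have hRb : ∀ x ∈ Set.Icc a b, |R x| ≤ |A' x| / (2 * s) + 2 * M * (w' x / (w x ^ 2 + s ^ 2)) := by
    intro x hx
    have h1 := hM x hx
    have h2 := Real.abs_cos_le_one (φ x)
    have h3 := Real.abs_sin_le_one (φ x)
    have h4 := hlow x hx
    have hw0 : 0 ≤ w' x := (sq_nonneg s).trans h4
    have hp := hpos (w x)
    have e1 : |A' x * Real.cos (φ x) * (w x / (w x ^ 2 + s ^ 2))| ≤ |A' x| * 1 * (1 / (2 * s)) := by
      simp only [abs_mul]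
      gcongr
      exact hg _
    have e2 : |A x * Real.cos (φ x) * ((s ^ 2 - w x ^ 2) / (w x ^ 2 + s ^ 2) ^ 2 * w' x)|
        ≤ M * 1 * (1 / (w x ^ 2 + s ^ 2) * w' x) := by
      simp only [abs_mul]
      rw [abs_of_nonneg hw0]
      gcongr
      rw [abs_div, abs_of_pos (pow_pos hp 2), div_le_div_iff₀ (pow_pos hp 2) hp, one_mul]
      refine (mul_le_mul_of_nonneg_right ?_ hp.le).trans_eq (sq _).symm
      rw [abs_le]
      constructor <;> nlinarith [sq_nonneg (w x), sq_nonneg s]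
    have e3 : |A x * Real.sin (φ x) * (s ^ 2 / (w x ^ 2 + s ^ 2))|
        ≤ M * 1 * (w' x / (w x ^ 2 + s ^ 2)) := by
      simp only [abs_mul]
      rw [abs_of_nonneg (by positivity : 0 ≤ s ^ 2 / (w x ^ 2 + s ^ 2))]
      gcongr
    refine (abs_add_three _ _ _).trans ((add_le_add_three e1 e2 e3).trans (le_of_eq ?_))
    field_simp
    ring
  have hatan : ∫ x in a..b, w' x / (w x ^ 2 + s ^ 2) ≤ Real.pi / s := by
    have hd : ∀ x ∈ Set.uIcc a b,
        HasDerivAt (fun x => Real.arctan (w x / s) / s) (w' x / (w x ^ 2 + s ^ 2)) x := by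
      intro x hx
      rw [Set.uIcc_of_le hab] at hx
      refine ((((hw x hx).div_const s).arctan).div_const s).congr_deriv ?_
      have := (hpos (w x)).ne'
      have : 1 + (w x / s) ^ 2 ≠ 0 := by positivity
      field_simp
      ring
    rw [intervalIntegral.integral_eq_sub_of_hasDerivAt hd
      (hint (hw'.div (by fun_prop) fun x _ => (hpos _).ne')), ← sub_div]
    gcongr
    linarith [Real.arctan_lt_pi_div_two (w b / s), Real.neg_pi_div_two_lt_arctan (w a / s)]
  have hc2 : ContinuousOn (fun x => w' x / (w x ^ 2 + s ^ 2)) (Set.Icc a b) :=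
    hw'.div (by fun_prop) fun x _ => (hpos _).ne'
  have hRint : |∫ x in a..b, R x| ≤ (∫ x in a..b, |A' x|) / (2 * s) + 2 * M * (Real.pi / s) := by
    calc |∫ x in a..b, R x| ≤ ∫ x in a..b, |R x| :=
          intervalIntegral.abs_integral_le_integral_abs hab
      _ ≤ ∫ x in a..b, (|A' x| / (2 * s) + 2 * M * (w' x / (w x ^ 2 + s ^ 2))) := by
          refine intervalIntegral.integral_mono_on hab (hint hRc.abs) (hint ?_) hRb
          exact (hA'.abs.div_const _).add (hc2.const_mul _)
      _ = (∫ x in a..b, |A' x|) / (2 * s) + 2 * M * ∫ x in a..b, w' x / (w x ^ 2 + s ^ 2) := by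
          rw [intervalIntegral.integral_add (hint (hA'.abs.div_const _))
            (hint (hc2.const_mul _)), intervalIntegral.integral_div,
            intervalIntegral.integral_const_mul]
      _ ≤ _ := by gcongr
  have hfin : ∫ x in a..b, A x * Real.sin (φ x) = (∫ x in a..b, R x) - H b + H a := by linarith
  rw [hfin]
  have ha := hHb a ⟨le_rfl, hab⟩
  have hb := hHb b ⟨hab, le_rfl⟩
  have hsum : ((2 * Real.pi + 1) * M + (∫ x in a..b, |A' x|) / 2) / s =
      (∫ x in a..b, |A' x|) / (2 * s) + 2 * M * (Real.pi / s) + M / (2 * s) + M / (2 * s) := by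
    field_simp
    ring
  rw [hsum]
  rw [abs_le] at *
  constructor <;> linarith

theorem hasDerivAt_sqrt_pow_four_add_sq {m : ℝ} (hm : m ≠ 0) (x : ℝ) :
    HasDerivAt (fun x => √(x ^ 4 + m ^ 2)) (2 * x ^ 3 / √(x ^ 4 + m ^ 2)) x := by
  have hp : 0 < x ^ 4 + m ^ 2 := by positivity
  refine (((hasDerivAt_pow 4 x).add_const (m ^ 2)).sqrt hp.ne').congr_deriv ?_
  have := (Real.sqrt_pos.2 hp).ne'
  field_simp
  norm_num

theorem abs_integral_cos_mul_sin_sqrt_le {a b m t K V : ℝ} (z : ℝ) (ha : 0 < a) (hab : a ≤ b)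
    (hm : m ≠ 0) (ht : t ≠ 0) {c c' : ℝ → ℝ} (hc : ∀ x, HasDerivAt c (c' x) x)
    (hc' : Continuous c') (hK : ∀ x, |c x| ≤ K) (hV : ∫ x in a..b, |c' x| ≤ V) :
    |∫ x in a..b, Real.cos (z * x) * (Real.sin (t * √(x ^ 4 + m ^ 2)) / √(x ^ 4 + m ^ 2) * c x)| ≤
      10 * (K + V) / (√|t| * a * √(√(a ^ 4 + m ^ 2))) := by
  wlog ht0 : 0 < t generalizing t
  · have h := this (t := -t) (neg_ne_zero.2 ht) (by grind)
    simpa only [neg_mul, Real.sin_neg, neg_div, mul_neg, intervalIntegral.integral_neg, abs_neg]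
      using h
  set ψ : ℝ → ℝ := fun x => √(x ^ 4 + m ^ 2) with hψ
  have hψ0 : ∀ x, 0 < ψ x := fun x => Real.sqrt_pos.2 (by positivity)
  have hψsq : ∀ x, ψ x ^ 2 = x ^ 4 + m ^ 2 := fun x => Real.sq_sqrt (by positivity)
  have hψd : ∀ x, HasDerivAt ψ (2 * x ^ 3 / ψ x) x := hasDerivAt_sqrt_pow_four_add_sq hm
  have hψc : Continuous ψ := by fun_prop
  have hψn : ∀ x, ψ x ≠ 0 := fun x => (hψ0 x).ne'
  have hcc : Continuous c := continuous_iff_continuousAt.2 fun x => (hc x).continuousAt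
  have hψmono : ∀ x ∈ Set.Icc a b, ψ a ≤ ψ x := by
    intro x hx
    exact Real.sqrt_le_sqrt (by gcongr; exact hx.1)
  have hK0 : 0 ≤ K := (abs_nonneg _).trans (hK 0)
  have hV0 : 0 ≤ V := (intervalIntegral.integral_nonneg hab fun _ _ => abs_nonneg _).trans hV
  set A' : ℝ → ℝ := fun x => c' x / ψ x - c x * (2 * x ^ 3 / ψ x) / ψ x ^ 2 with hA'def
  have hA'c : Continuous A' := by
    have : ∀ x, ψ x ^ 2 ≠ 0 := fun x => pow_ne_zero _ (hψn x)
    fun_prop (disch := assumption)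
  have hA : ∀ x, HasDerivAt (fun x => c x / ψ x) (A' x) x := by
    intro x
    refine ((hc x).div (hψd x) (hψn x)).congr_deriv ?_
    have := hψn x
    simp only [hA'def]
    field_simp
  have hqc : Continuous fun x => (2 * x ^ 3 / ψ x) / ψ x ^ 2 := by
    have : ∀ x, ψ x ^ 2 ≠ 0 := fun x => pow_ne_zero _ (hψn x)
    fun_prop (disch := assumption)
  have hq : ∫ x in a..b, (2 * x ^ 3 / ψ x) / ψ x ^ 2 ≤ 1 / ψ a := by
    have hd : ∀ x ∈ Set.uIcc a b,
        HasDerivAt (fun x => -(ψ x)⁻¹) ((2 * x ^ 3 / ψ x) / ψ x ^ 2) x := fun x _ =>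
      ((hψd x).inv (hψn x)).neg.congr_deriv (by ring)
    rw [intervalIntegral.integral_eq_sub_of_hasDerivAt hd (hqc.intervalIntegrable _ _)]
    have := inv_pos.2 (hψ0 b)
    rw [one_div]
    linarith
  have hA'int : ∫ x in a..b, |A' x| ≤ (K + V) / ψ a := by
    have h1 : ContinuousOn (fun x => |c' x| / ψ a + K * ((2 * x ^ 3 / ψ x) / ψ x ^ 2))
      (Set.Icc a b) := by fun_prop
    calc ∫ x in a..b, |A' x|
        ≤ ∫ x in a..b, (|c' x| / ψ a + K * ((2 * x ^ 3 / ψ x) / ψ x ^ 2)) := by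
          refine intervalIntegral.integral_mono_on hab (hA'c.abs.intervalIntegrable _ _)
            (h1.intervalIntegrable_of_Icc hab) fun x hx => ?_
          have hx0 : 0 ≤ x := ha.le.trans hx.1
          have h2 := hψmono x hx
          have h3 := hK x
          have h4 := hψ0 a
          have h5 := hψ0 x
          refine (abs_sub _ _).trans ?_
          rw [abs_div, abs_of_pos h5, mul_div_assoc, abs_mul,
            abs_of_nonneg (by positivity : 0 ≤ 2 * x ^ 3 / ψ x / ψ x ^ 2)]
          gcongr
      _ = (∫ x in a..b, |c' x|) / ψ a + K * ∫ x in a..b, (2 * x ^ 3 / ψ x) / ψ x ^ 2 := by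
          rw [intervalIntegral.integral_add (Continuous.intervalIntegrable (by fun_prop) _ _)
            (Continuous.intervalIntegrable (by fun_prop) _ _), intervalIntegral.integral_div,
            intervalIntegral.integral_const_mul]
      _ ≤ V / ψ a + K * (1 / ψ a) := by
          have := hψ0 a
          gcongr
      _ = _ := by ring
  set w' : ℝ → ℝ := fun x => t * (6 * x ^ 2 / ψ x - 4 * x ^ 6 / ψ x ^ 3) with hw'def
  have hw'c : Continuous w' := by
    have : ∀ x, ψ x ^ 3 ≠ 0 := fun x => pow_ne_zero _ (hψn x)
    fun_prop (disch := assumption)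
  set lam := t * (a ^ 2 / ψ a) with hlam
  have hlam0 : 0 < lam := by have := hψ0 a; positivity
  have hlow : ∀ x ∈ Set.Icc a b, lam ≤ w' x := by
    intro x hx
    have hax : a ≤ x := hx.1
    have h1 : a ^ 2 / ψ a ≤ x ^ 2 / ψ x := by
      rw [div_le_div_iff₀ (hψ0 a) (hψ0 x)]
      have := hψ0 a
      have h4 : a ^ 4 ≤ x ^ 4 := by gcongr
      refine (pow_le_pow_iff_left₀ (by have := hψ0 x; positivity) (by positivity)
        two_ne_zero).1 ?_
      rw [mul_pow, mul_pow, hψsq, hψsq]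
      nlinarith [mul_le_mul_of_nonneg_right h4 (sq_nonneg m)]
    have h2 : x ^ 2 / ψ x ≤ 6 * x ^ 2 / ψ x - 4 * x ^ 6 / ψ x ^ 3 := by
      have h5 := hψ0 x
      have : 6 * x ^ 2 / ψ x - 4 * x ^ 6 / ψ x ^ 3 - x ^ 2 / ψ x
          = x ^ 2 * (5 * ψ x ^ 2 - 4 * x ^ 4) / ψ x ^ 3 := by
        field_simp
        ring
      have h6 : 0 ≤ x ^ 2 * (5 * ψ x ^ 2 - 4 * x ^ 4) / ψ x ^ 3 := by
        have : 0 ≤ 5 * ψ x ^ 2 - 4 * x ^ 4 := by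
          rw [hψsq]
          nlinarith [sq_nonneg m, pow_nonneg (sq_nonneg x) 2]
        positivity
      linarith
    exact mul_le_mul_of_nonneg_left (h1.trans h2) ht0.le
  have hψa := hψ0 a
  have key : ∀ y : ℝ, |∫ x in a..b, c x / ψ x * Real.sin (t * ψ x + y * x)| ≤
      10 * (K + V) / (√|t| * a * √(ψ a)) := by
    intro y
    refine (abs_integral_mul_sin_le (w := fun x => t * (2 * x ^ 3 / ψ x) + y) (w' := w')
      (M := K / ψ a) hab hlam0
      (fun x _ => hA x) (fun x _ => ?_) (fun x _ => ?_) hA'c.continuousOn hw'c.continuousOn hlow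
      (fun x hx => ?_)).trans ?_
    · exact (((hψd x).const_mul t).add ((hasDerivAt_id x).const_mul y)).congr_deriv (by simp)
    · refine ((((((hasDerivAt_pow 3 x).const_mul 2).div (hψd x)
        (hψn x))).const_mul t).add_const y).congr_deriv ?_
      have := hψn x
      simp only [hw'def]
      field_simp
      norm_num
      ring
    · rw [abs_div, abs_of_pos (hψ0 x)]
      exact div_le_div₀ hK0 (hK x) hψa (hψmono x hx)
    · have hsl : √lam = √t * a / √(ψ a) := by
        rw [hlam, Real.sqrt_mul ht0.le, Real.sqrt_div (sq_nonneg a), Real.sqrt_sq ha.le]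
        ring
      have hst : 0 < √t := Real.sqrt_pos.2 ht0
      have hsψ : 0 < √(ψ a) := Real.sqrt_pos.2 hψa
      rw [hsl, abs_of_pos ht0]
      have hpi := Real.pi_lt_four
      calc _ ≤ ((2 * 4 + 1) * (K / ψ a) + ((K + V) / ψ a) / 2) / (√t * a / √(ψ a)) := by
            gcongr
        _ ≤ (10 * (K + V) / ψ a) / (√t * a / √(ψ a)) := by
            gcongr
            have : (0:ℝ) ≤ K / ψ a := by positivity
            have : (0:ℝ) ≤ V / ψ a := by positivity
            simp only [mul_div_assoc, add_div]
            linarith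
        _ = 10 * (K + V) / (√t * a * √(ψ a)) := by
            rw [← Real.sq_sqrt hψa.le]
            simp only [Real.sqrt_sq hsψ.le]
            field_simp
  have hsplit : ∀ x, Real.cos (z * x) * (Real.sin (t * ψ x) / ψ x * c x) =
      (c x / ψ x * Real.sin (t * ψ x + z * x) + c x / ψ x * Real.sin (t * ψ x + -z * x)) / 2 := by
    intro x
    rw [neg_mul, ← sub_eq_add_neg, Real.sin_add, Real.sin_sub]
    ring
  have hci : ∀ y : ℝ, IntervalIntegrable (fun x => c x / ψ x * Real.sin (t * ψ x + y * x))
      volume a b := fun y => Continuous.intervalIntegrable (by fun_prop (disch := assumption)) _ _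
  have h1 := key z
  have h2 := key (-z)
  change |∫ x in a..b, Real.cos (z * x) * (Real.sin (t * ψ x) / ψ x * c x)| ≤ _
  simp only [hsplit]
  rw [intervalIntegral.integral_div, intervalIntegral.integral_add (hci _) (hci _), abs_div, abs_two]
  have := abs_add_le (∫ x in a..b, c x / ψ x * Real.sin (t * ψ x + z * x))
    (∫ x in a..b, c x / ψ x * Real.sin (t * ψ x + -z * x))
  linarith

theorem norm_integral_exp_mul_le_of_even {h : ℝ → ℝ} (hi : Integrable h) (heven : h.Even) {B : ℝ}
    (hB : ∀ z : ℝ, ∀ᶠ b in Filter.atTop, |∫ x in (0 : ℝ)..b, Real.cos (z * x) * h x| ≤ B) (z : ℝ) :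
    ‖∫ x : ℝ, Complex.exp (Complex.I * ((z * x : ℝ) : ℂ)) * (h x : ℂ)‖ ≤ 2 * B := by
  set g : ℝ → ℂ := fun x => Complex.exp (Complex.I * ((z * x : ℝ) : ℂ)) * (h x : ℂ) with hg
  have hgi : Integrable g := by
    refine hi.ofReal.bdd_mul (c := 1) (by fun_prop) (ae_of_all _ fun x => ?_)
    rw [mul_comm, Complex.norm_exp_ofReal_mul_I]
  have hlim := intervalIntegral_tendsto_integral hgi Filter.tendsto_neg_atTop_atBot
    Filter.tendsto_id
  refine le_of_tendsto hlim.norm ?_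
  filter_upwards [hB z] with b hb
  have hii : ∀ a b : ℝ, IntervalIntegrable g volume a b := fun a b => hgi.intervalIntegrable
  have hneg : ∫ x in (-b)..0, g x = ∫ x in (0 : ℝ)..b, g (-x) := by
    rw [intervalIntegral.integral_comp_neg, neg_zero]
  have hin : IntervalIntegrable (fun x => g (-x)) volume 0 b := hgi.comp_neg.intervalIntegrable
  have hsum : ∫ x in (-b)..b, g x =
      ((2 * ∫ x in (0 : ℝ)..b, Real.cos (z * x) * h x : ℝ) : ℂ) := by
    rw [← intervalIntegral.integral_add_adjacent_intervals (hii (-b) 0) (hii 0 b), hneg,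
      ← intervalIntegral.integral_add hin (hii 0 b), ← intervalIntegral.integral_const_mul,
      ← intervalIntegral.integral_ofReal]
    refine intervalIntegral.integral_congr fun x _ => ?_
    simp only [hg, heven x]
    push_cast
    rw [Complex.cos]
    ring_nf
  simp only [id]
  rw [hsum, Complex.norm_real, Real.norm_eq_abs, abs_mul, abs_two]
  gcongr

theorem norm_fourier_multiplier_le {h : ℝ → ℝ} (hi : Integrable h) {B : ℝ}
    (hB : ∀ z : ℝ, ‖∫ ξ : ℝ, Complex.exp (Complex.I * ((z * ξ : ℝ) : ℂ)) * (h ξ : ℂ)‖ ≤ B)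
    {f : ℝ → ℂ} (hf : Integrable f) (x : ℝ) :
    ‖∫ ξ : ℝ, Complex.exp (Complex.I * ((x * ξ : ℝ) : ℂ)) * (h ξ : ℂ)
      * (∫ y : ℝ, Complex.exp (-(Complex.I * ((y * ξ : ℝ) : ℂ))) * f y)‖
      ≤ B * ∫ y : ℝ, ‖f y‖ := by
  have hprod : Integrable (Function.uncurry fun ξ y : ℝ =>
      Complex.exp (Complex.I * (((x - y) * ξ : ℝ) : ℂ)) * ((h ξ : ℂ) * f y))
      (volume.prod volume) := by
    refine (hi.ofReal.mul_prod hf).bdd_mul (c := 1)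
      (f := fun p : ℝ × ℝ => Complex.exp (Complex.I * (((x - p.2) * p.1 : ℝ) : ℂ)))
      (Continuous.aestronglyMeasurable (by fun_prop)) (ae_of_all _ fun p => ?_)
    rw [mul_comm, Complex.norm_exp_ofReal_mul_I]
  have h1 : ∫ ξ : ℝ, Complex.exp (Complex.I * ((x * ξ : ℝ) : ℂ)) * (h ξ : ℂ)
      * (∫ y : ℝ, Complex.exp (-(Complex.I * ((y * ξ : ℝ) : ℂ))) * f y) =
      ∫ y : ℝ, (∫ ξ : ℝ, Complex.exp (Complex.I * (((x - y) * ξ : ℝ) : ℂ)) * (h ξ : ℂ)) * f y := by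
    simp only [← integral_mul_const]
    rw [← integral_integral_swap (by simpa only [mul_assoc] using hprod)]
    refine integral_congr_ae (ae_of_all _ fun ξ => ?_)
    simp only [← integral_const_mul]
    refine integral_congr_ae (ae_of_all _ fun y => ?_)
    have : Complex.exp (Complex.I * (((x - y) * ξ : ℝ) : ℂ)) =
      Complex.exp (Complex.I * ((x * ξ : ℝ) : ℂ)) * Complex.exp (-(Complex.I * ((y * ξ : ℝ) : ℂ))) := by
      rw [← Complex.exp_add]
      push_cast
      ring_nf
    simp only [this]
    ring
  rw [h1, ← integral_const_mul]
  refine norm_integral_le_of_norm_le (hf.norm.const_mul B) (ae_of_all _ fun y => ?_)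
  rw [norm_mul]
  exact mul_le_mul_of_nonneg_right (hB _) (norm_nonneg _)

theorem integrable_sin_sqrt_div_sqrt_mul {m K : ℝ} (hm : m ≠ 0) (t : ℝ) {c : ℝ → ℝ}
    (hc : Continuous c) (hK : ∀ x, |c x| ≤ K) :
    Integrable fun x : ℝ => Real.sin (t * √(x ^ 4 + m ^ 2)) / √(x ^ 4 + m ^ 2) * c x := by
  set κ := min 1 |m| / 2 with hκ
  have hκ0 : 0 < κ := by have := abs_pos.2 hm; positivity
  have hK0 : 0 ≤ K := (abs_nonneg _).trans (hK 0)
  have hψ : ∀ x : ℝ, 0 < √(x ^ 4 + m ^ 2) := fun x => Real.sqrt_pos.2 (by positivity)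
  have hlow : ∀ x : ℝ, κ * (1 + x ^ 2) ≤ √(x ^ 4 + m ^ 2) := by
    intro x
    refine Real.le_sqrt_of_sq_le ?_
    have h1 : (2 * κ) ^ 2 ≤ 1 := by
      have : 2 * κ ≤ 1 := by rw [hκ]; linarith [min_le_left 1 |m|]
      nlinarith
    have h2 : (2 * κ) ^ 2 ≤ m ^ 2 := by
      have : 2 * κ ≤ |m| := by rw [hκ]; linarith [min_le_right 1 |m|]
      rw [← sq_abs m]
      gcongr
    nlinarith [mul_le_mul_of_nonneg_right h1 (pow_nonneg (sq_nonneg x) 2),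
      mul_nonneg (sq_nonneg κ) (sq_nonneg (1 - x ^ 2)), sq_nonneg (κ * (1 + x ^ 2))]
  have hn : ∀ x : ℝ, √(x ^ 4 + m ^ 2) ≠ 0 := fun x => (hψ x).ne'
  refine (integrable_inv_one_add_sq.const_mul (K / κ)).mono'
    (Continuous.aestronglyMeasurable (by fun_prop (disch := assumption))) (ae_of_all _ fun x => ?_)
  rw [Real.norm_eq_abs, abs_mul, abs_div, abs_of_pos (hψ x)]
  calc _ ≤ 1 / (κ * (1 + x ^ 2)) * K := by
        gcongr
        · exact Real.abs_sin_le_one _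
        · exact hlow x
        · exact hK x
    _ = _ := by field_simp

theorem abs_integral_zero_cos_mul_sin_sqrt_le {b m t K V δ : ℝ} (z : ℝ) (hδ : 0 < δ) (hb : δ ≤ b)
    (hm : m ≠ 0) (ht : t ≠ 0) {c c' : ℝ → ℝ} (hc : ∀ x, HasDerivAt c (c' x) x)
    (hc' : Continuous c') (hK : ∀ x, |c x| ≤ K) (hV : ∫ x in δ..b, |c' x| ≤ V) :
    |∫ x in (0 : ℝ)..b,
        Real.cos (z * x) * (Real.sin (t * √(x ^ 4 + m ^ 2)) / √(x ^ 4 + m ^ 2) * c x)| ≤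
      δ * K / |m| + 10 * (K + V) / (√|t| * δ * √|m|) := by
  have hm0 := abs_pos.2 hm
  have ht0 := abs_pos.2 ht
  have hK0 : 0 ≤ K := (abs_nonneg _).trans (hK 0)
  have hV0 : 0 ≤ V := (intervalIntegral.integral_nonneg hb fun _ _ => abs_nonneg _).trans hV
  have hψm : ∀ x : ℝ, |m| ≤ √(x ^ 4 + m ^ 2) := fun x =>
    Real.abs_le_sqrt (by nlinarith [pow_nonneg (sq_nonneg x) 2])
  have hn : ∀ x : ℝ, √(x ^ 4 + m ^ 2) ≠ 0 := fun x => (hm0.trans_le (hψm x)).ne'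
  have hcc : Continuous c := continuous_iff_continuousAt.2 fun x => (hc x).continuousAt
  have hcont : Continuous fun x =>
      Real.cos (z * x) * (Real.sin (t * √(x ^ 4 + m ^ 2)) / √(x ^ 4 + m ^ 2) * c x) := by
    fun_prop (disch := assumption)
  rw [← intervalIntegral.integral_add_adjacent_intervals (hcont.intervalIntegrable 0 δ)
    (hcont.intervalIntegrable δ b)]
  refine (abs_add_le _ _).trans (add_le_add ?_ ?_)
  · have := intervalIntegral.norm_integral_le_of_norm_le_const (a := 0) (b := δ) (C := K / |m|)
      (f := fun x =>
        Real.cos (z * x) * (Real.sin (t * √(x ^ 4 + m ^ 2)) / √(x ^ 4 + m ^ 2) * c x))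
      (fun x _ => ?_)
    · rw [Real.norm_eq_abs, sub_zero, abs_of_pos hδ] at this
      exact this.trans_eq (by ring)
    · rw [Real.norm_eq_abs, abs_mul, abs_mul, abs_div, abs_of_nonneg (Real.sqrt_nonneg _)]
      calc _ ≤ 1 * (1 / |m| * K) := by
            gcongr
            · exact Real.abs_cos_le_one _
            · exact Real.abs_sin_le_one _
            · exact hψm x
            · exact hK x
        _ = _ := by ring
  · refine (abs_integral_cos_mul_sin_sqrt_le z hδ hb hm ht hc hc' hK hV).trans ?_
    gcongr
    exact hψm δ

theorem norm_multiplier_le_of_even {m t B : ℝ} (hm : m ≠ 0) {c : ℝ → ℝ} {K : ℝ}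
    (hc : Continuous c) (hK : ∀ x, |c x| ≤ K) (heven : c.Even)
    (hB : ∀ z : ℝ, ∀ᶠ b in Filter.atTop, |∫ x in (0 : ℝ)..b,
      Real.cos (z * x) * (Real.sin (t * √(x ^ 4 + m ^ 2)) / √(x ^ 4 + m ^ 2) * c x)| ≤ B)
    {f : ℝ → ℂ} (hf : Integrable f) (x : ℝ) :
    ‖(2 * Real.pi)⁻¹ • ∫ ξ : ℝ,
      Complex.exp (Complex.I * ((x * ξ : ℝ) : ℂ))
      * ((Real.sin (t * Real.sqrt (ξ^4 + m^2)) / Real.sqrt (ξ^4 + m^2) : ℝ) : ℂ)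
      * ((c ξ : ℝ) : ℂ)
      * (∫ y : ℝ, Complex.exp (-(Complex.I * ((y * ξ : ℝ) : ℂ))) * f y)‖
    ≤ B * ∫ y : ℝ, ‖f y‖ := by
  have hi := integrable_sin_sqrt_div_sqrt_mul hm t hc hK
  have hB0 : 0 ≤ B := by
    obtain ⟨b, hb⟩ := (hB 0).exists
    exact (abs_nonneg _).trans hb
  have h := norm_fourier_multiplier_le hi (norm_integral_exp_mul_le_of_even hi
    (fun x => by simp only [heven x, Even.neg_pow (by decide : Even 4)]) hB) hf x
  simp only [Complex.ofReal_mul (Real.sin _ / _) (c _), ← mul_assoc] at h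
  have hπ := Real.pi_gt_three
  rw [norm_smul, Real.norm_of_nonneg (by positivity)]
  have hI : 0 ≤ ∫ y : ℝ, ‖f y‖ := integral_nonneg fun _ => norm_nonneg _
  calc _ ≤ (2 * Real.pi)⁻¹ * (2 * B * ∫ y : ℝ, ‖f y‖) := by gcongr
    _ ≤ (2 * 1)⁻¹ * (2 * B * ∫ y : ℝ, ‖f y‖) := by gcongr; linarith
    _ = _ := by ring

/-- Free massive estimates for `sin(t√(Δ²+m²))/√(Δ²+m²)` (Proposition 2.4):
`‖(sin(t√(Δ²+m²))/√(Δ²+m²)) χ₁(Δ²)‖_{L¹→L^∞} ≲ |m|⁻¹ ⟨m⟩^{1/2} |t|^{-1/4}` and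
`‖(sin(t√(Δ²+m²))/√(Δ²+m²)) χ₂(Δ²)‖_{L¹→L^∞} ≲ (1 + 1/|m|) |t|^{-1/2}`,
with `χ₂ = 1 - χ₁` and `⟨m⟩ = 1 + |m|`. -/
theorem stmt_12 (lam₀ : ℝ) (hlam₀ : 0 < lam₀)
    (χ₁ : ℝ → ℝ) (hχ₁ : ContDiff ℝ (⊤ : ℕ∞) χ₁) (hχ₁c : HasCompactSupport χ₁)
    (hχ₁one : ∀ lam : ℝ, |lam| ≤ lam₀ → χ₁ lam = 1)
    (hχ₁zero : ∀ lam : ℝ, 2 * lam₀ ≤ |lam| → χ₁ lam = 0) :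
    ∃ C > 0, ∀ m : ℝ, m ≠ 0 → ∀ t : ℝ, t ≠ 0 → ∀ f : SchwartzMap ℝ ℂ, ∀ x : ℝ,
      (‖(2 * Real.pi)⁻¹ • ∫ ξ : ℝ,
          Complex.exp (Complex.I * ((x * ξ : ℝ) : ℂ))
          * ((Real.sin (t * Real.sqrt (ξ^4 + m^2)) / Real.sqrt (ξ^4 + m^2) : ℝ) : ℂ)
          * ((χ₁ (ξ^4) : ℝ) : ℂ)
          * (∫ y : ℝ, Complex.exp (-(Complex.I * ((y * ξ : ℝ) : ℂ))) * f y)‖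
        ≤ C * |m|⁻¹ * (1 + |m|) ^ ((1:ℝ)/2) * |t| ^ (-(1/4) : ℝ)
            * ∫ y : ℝ, ‖f y‖) ∧
      (‖(2 * Real.pi)⁻¹ • ∫ ξ : ℝ,
          Complex.exp (Complex.I * ((x * ξ : ℝ) : ℂ))
          * ((Real.sin (t * Real.sqrt (ξ^4 + m^2)) / Real.sqrt (ξ^4 + m^2) : ℝ) : ℂ)
          * ((1 - χ₁ (ξ^4) : ℝ) : ℂ)
          * (∫ y : ℝ, Complex.exp (-(Complex.I * ((y * ξ : ℝ) : ℂ))) * f y)‖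
        ≤ C * (1 + |m|⁻¹) * |t| ^ (-(1/2) : ℝ) * ∫ y : ℝ, ‖f y‖) := by
  obtain ⟨K, hK⟩ := hχ₁c.exists_bound_of_continuous hχ₁.continuous
  simp only [Real.norm_eq_abs] at hK
  have hK0 : 0 ≤ K := (abs_nonneg _).trans (hK 0)
  have hχd : Continuous (deriv χ₁) := hχ₁.continuous_deriv (by simp)
  set c' : ℝ → ℝ := fun x => deriv χ₁ (x ^ 4) * (4 * x ^ 3) with hc'def
  have hc'c : Continuous c' := by fun_prop
  have hc : ∀ x, HasDerivAt (fun x => χ₁ (x ^ 4)) (c' x) x := fun x => by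
    have h1 : HasDerivAt χ₁ (deriv χ₁ (x ^ 4)) (x ^ 4) :=
      ((hχ₁.differentiable (by simp)) _).hasDerivAt
    exact (HasDerivAt.comp (h := fun x : ℝ => x ^ 4) x h1 (hasDerivAt_pow 4 x)).congr_deriv
      (by norm_num [hc'def])
  have hc'i : Integrable c' := by
    refine hc'c.integrable_of_hasCompactSupport ?_
    have hcomp : HasCompactSupport fun x : ℝ => χ₁ (x ^ 4) := by
      refine HasCompactSupport.intro (K := Set.Icc (-(1 + 2 * lam₀)) (1 + 2 * lam₀))
        isCompact_Icc fun x hx => hχ₁zero _ ?_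
      rw [Set.mem_Icc, ← abs_le, not_le] at hx
      rw [abs_pow]
      nlinarith [pow_le_pow_right₀ (by linarith : 1 ≤ |x|) (by norm_num : 1 ≤ 4)]
    rw [show c' = deriv fun x => χ₁ (x ^ 4) from funext fun x => (hc x).deriv.symm]
    exact hcomp.deriv
  set V := ∫ x, |c' x| with hVdef
  have hV0 : 0 ≤ V := integral_nonneg fun _ => abs_nonneg _
  have hV : ∀ a b : ℝ, a ≤ b → ∫ x in a..b, |c' x| ≤ V := fun a b hab => by
    rw [intervalIntegral.integral_of_le hab]
    exact setIntegral_le_integral hc'i.abs (ae_of_all _ fun _ => abs_nonneg _)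
  set r := √(√lam₀) with hr
  have hr0 : 0 < r := Real.sqrt_pos.2 (Real.sqrt_pos.2 hlam₀)
  have hr4 : r ^ 4 = lam₀ := by
    rw [show r ^ 4 = (r ^ 2) ^ 2 by ring, Real.sq_sqrt (Real.sqrt_nonneg _),
      Real.sq_sqrt hlam₀.le]
  set C := 11 * (1 + K + V) + 10 * (1 + K + V) / r ^ 2 with hC
  refine ⟨C, by positivity, fun m hm t ht f x => ⟨?_, ?_⟩⟩
  · have hm0 := abs_pos.2 hm
    have ht0 := abs_pos.2 ht
    have hsm := Real.sqrt_pos.2 hm0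
    have hst := Real.sqrt_pos.2 ht0
    set p := √(√|m|) with hp
    set q := √(√|t|) with hq
    have hp0 : 0 < p := Real.sqrt_pos.2 hsm
    have hq0 : 0 < q := Real.sqrt_pos.2 hst
    have hp2 : √|m| = p ^ 2 := (Real.sq_sqrt hsm.le).symm
    have hq2 : √|t| = q ^ 2 := (Real.sq_sqrt hst.le).symm
    have hp4 : |m| = p ^ 4 := by
      rw [← Real.sq_sqrt hm0.le, hp2]
      ring
    have hq4 : |t| ^ (-(1/4) : ℝ) = q⁻¹ := by
      rw [Real.rpow_neg ht0.le, hq, Real.sqrt_eq_rpow, Real.sqrt_eq_rpow, ← Real.rpow_mul ht0.le]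
      norm_num
    have hpm : p ≤ (1 + |m|) ^ ((1:ℝ)/2) := by
      rw [← Real.sqrt_eq_rpow]
      refine Real.le_sqrt_of_sq_le ?_
      rw [hp4]
      nlinarith [sq_nonneg (p ^ 2 - 1)]
    refine norm_multiplier_le_of_even hm (c := fun ξ => χ₁ (ξ ^ 4)) (K := K)
      (hχ₁.continuous.comp (continuous_pow 4)) (fun _ => hK _)
      (fun y => by simp only [Even.neg_pow (by decide : Even 4)]) (fun z => ?_) f.integrable x
    filter_upwards [Filter.eventually_ge_atTop (p / q)] with b hb
    have hd : 0 < p / q := by positivity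
    refine (abs_integral_zero_cos_mul_sin_sqrt_le z hd hb hm ht hc hc'c (fun _ => hK _)
      (hV _ _ hb)).trans ?_
    rw [hq4, hp2, hq2, hp4]
    rw [hp4] at hpm
    calc p / q * K / p ^ 4 + 10 * (K + V) / (q ^ 2 * (p / q) * p ^ 2)
        = (11 * K + 10 * V) * (p ^ 4)⁻¹ * p * q⁻¹ := by
          field_simp
          ring
      _ ≤ C * (p ^ 4)⁻¹ * (1 + p ^ 4) ^ ((1:ℝ)/2) * q⁻¹ := by
          have : 0 ≤ 10 * (1 + K + V) / r ^ 2 := by positivity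
          gcongr
          rw [hC]
          linarith
  · have hm0 := abs_pos.2 hm
    have ht0 := abs_pos.2 ht
    have hst := Real.sqrt_pos.2 ht0
    have hc2 : ∀ x, HasDerivAt (fun x => 1 - χ₁ (x ^ 4)) (-c' x) x := fun x => (hc x).const_sub 1
    have hK2 : ∀ y : ℝ, |1 - χ₁ (y ^ 4)| ≤ 1 + K := fun y =>
      (abs_sub _ _).trans (by rw [abs_one]; gcongr; exact hK _)
    refine norm_multiplier_le_of_even hm (c := fun ξ => 1 - χ₁ (ξ ^ 4)) (K := 1 + K)
      (continuous_const.sub (hχ₁.continuous.comp (continuous_pow 4))) hK2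
      (fun y => by simp only [Even.neg_pow (by decide : Even 4)]) (fun z => ?_) f.integrable x
    filter_upwards [Filter.eventually_ge_atTop r] with b hb
    have hzero : ∀ y ∈ Set.uIcc 0 r, Real.cos (z * y) *
        (Real.sin (t * √(y ^ 4 + m ^ 2)) / √(y ^ 4 + m ^ 2) * (1 - χ₁ (y ^ 4))) = 0 := by
      intro y hy
      rw [Set.uIcc_of_le hr0.le] at hy
      have h4 : y ^ 4 ≤ r ^ 4 := by
        have := hy.1
        gcongr
        exact hy.2
      rw [hχ₁one (y ^ 4) (by rw [abs_of_nonneg (by positivity), ← hr4]; exact h4)]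
      simp
    have hn : ∀ x : ℝ, √(x ^ 4 + m ^ 2) ≠ 0 := fun x => (Real.sqrt_pos.2 (by positivity)).ne'
    have hχcont := hχ₁.continuous
    have hcont : Continuous fun y => Real.cos (z * y) *
        (Real.sin (t * √(y ^ 4 + m ^ 2)) / √(y ^ 4 + m ^ 2) * (1 - χ₁ (y ^ 4))) := by
      fun_prop (disch := assumption)
    rw [← intervalIntegral.integral_add_adjacent_intervals (hcont.intervalIntegrable 0 r)
      (hcont.intervalIntegrable r b), intervalIntegral.integral_congr hzero,
      intervalIntegral.integral_zero, zero_add]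
    refine (abs_integral_cos_mul_sin_sqrt_le (K := 1 + K) (V := V) z hr0 hb hm ht hc2 hc'c.neg hK2
      (by simpa only [abs_neg] using hV _ _ hb)).trans ?_
    have hrs : r ≤ √(√(r ^ 4 + m ^ 2)) := by
      refine Real.le_sqrt_of_sq_le (Real.le_sqrt_of_sq_le ?_)
      nlinarith [sq_nonneg m]
    rw [Real.rpow_neg ht0.le, ← Real.sqrt_eq_rpow]
    calc 10 * (1 + K + V) / (√|t| * r * √(√(r ^ 4 + m ^ 2)))
        ≤ 10 * (1 + K + V) / (√|t| * r * r) := by gcongr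
      _ = (10 * (1 + K + V) / r ^ 2) * 1 * (√|t|)⁻¹ := by field_simp
      _ ≤ C * (1 + |m|⁻¹) * (√|t|)⁻¹ := by
          have h1 : 0 ≤ 11 * (1 + K + V) := by positivity
          have h2 := inv_pos.2 hm0
          gcongr
          · rw [hC]
            linarith
          · linarith
end
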